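/- In the fraction field ℚ(a, b, c, λ) of the polynomial ring in four variables a, b, c, λ over ℚ, set x = ac, y = a − ac − 1 and z = b/c − 1. Then ((x+y+1)⁴(z+1)/(x·y·z) + z + 1 − λ) · c(a − ac − 1)(b − c) = a³b − (λc − b)(b − c)(a − ac − 1). -/

import Mathlib

open MvPolynomial

theorem aux_ident {K : Type*} [Field K] (a b c l : K) (ha : a ≠ 0) (hc : c ≠ 0)
    (hy : a - a * c - 1 ≠ 0) (hbc : b - c ≠ 0) :
    ((a * c + (a - a * c - 1) + 1) ^ 4 * (b / c - 1 + 1) /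
      (a * c * (a - a * c - 1) * (b / c - 1)) + (b / c - 1) + 1 - l)
        * (c * (a - a * c - 1) * (b - c))
      = a ^ 3 * b - (l * c - b) * (b - c) * (a - a * c - 1) := by
  have h1 : a * c + (a - a * c - 1) + 1 = a := by ring
  have h2 : b / c - 1 = (b - c) / c := by field_simp
  rw [h1, sub_add_cancel, h2]
  generalize a - a * c - 1 = y at *
  generalize hd : b - c = d at *
  obtain rfl : b = d + c := by rw [← hd]; ring
  field_simp
  ring

theorem aux_ne (p : MvPolynomial (Fin 4) ℚ) (v : Fin 4 → ℚ) (h : eval v p ≠ 0) :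
    algebraMap (MvPolynomial (Fin 4) ℚ) (FractionRing (MvPolynomial (Fin 4) ℚ)) p ≠ 0 := by
  intro h0
  rw [map_eq_zero_iff _ (IsFractionRing.injective _ _)] at h0
  exact h (by rw [h0, map_zero])

/-- The change-of-variables identity for the Fano threefold `X₂₋₃` (Proposition 4.5):
in `ℚ(a, b, c, λ)`, with `x = ac`, `y = a − ac − 1`, `z = b/c − 1`, one has
`((x+y+1)⁴(z+1)/(xyz) + z + 1 − λ) · c(a − ac − 1)(b − c)
= a³b − (λc − b)(b − c)(a − ac − 1)`. -/
theorem stmt13 :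
    letI R := MvPolynomial (Fin 4) ℚ
    letI K := FractionRing R
    let a : K := algebraMap R K (X 0)
    let b : K := algebraMap R K (X 1)
    let c : K := algebraMap R K (X 2)
    let lam : K := algebraMap R K (X 3)
    let x : K := a * c
    let y : K := a - a * c - 1
    let z : K := b / c - 1
    ((x + y + 1) ^ 4 * (z + 1) / (x * y * z) + z + 1 - lam)
        * (c * (a - a * c - 1) * (b - c))
      = a ^ 3 * b - (lam * c - b) * (b - c) * (a - a * c - 1) := by
  intro a b c lam x y z
  refine aux_ident a b c lam ?_ ?_ ?_ ?_
  · exact aux_ne (X 0) (fun _ => 1) (by simp)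
  · exact aux_ne (X 2) (fun _ => 1) (by simp)
  · have := aux_ne (X 0 - X 0 * X 2 - 1) (fun _ => 0) (by simp)
    simpa only [map_sub, map_mul, map_one] using this
  · have := aux_ne (X 1 - X 2) (fun i => if i = 1 then 1 else 0) (by simp)
    simpa only [map_sub] using this
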